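/- With the hypotheses of the previous statement (τ satisfying the Schanuel condition, Γ ⊆ ℚ(τ)^{alg} divisible, Δ the ℚ(τ)-linear span of Γ in (ℝ_{>0},·)): if Γ has the Mann property over ℚ(τ), then Δ has the Mann property over ℚ(τ). -/

import Mathlib

open Real

noncomputable section

/-- The subfield ℚ(τ) of ℝ. -/
def Ktau (τ : ℝ) : Subfield ℝ := Subfield.closure {τ}

/-- Transcendence degree over a subfield K ⊆ ℝ of a finite tuple: the largest size of an
algebraically independent (over K) subfamily. -/
def tdeg (K : Subfield ℝ) {n : ℕ} (a : Fin n → ℝ) : ℕ :=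
  sSup {k | ∃ s : Finset (Fin n), s.card = k ∧
    AlgebraicIndependent K (fun i : s => a i)}

/-- The dimension of the K-linear span of a tuple of positive reals in the K-vector
space (ℝ_{>0},·) (scalar action q · a = a^q): the largest size of a multiplicatively
K-independent subfamily. -/
def mldim (K : Subfield ℝ) {n : ℕ} (a : Fin n → ℝ) : ℕ :=
  sSup {k | ∃ s : Finset (Fin n), s.card = k ∧
    ∀ c : Fin n → ℝ, (∀ i, c i ∈ K) → (∏ i ∈ s, a i ^ c i) = 1 → ∀ i ∈ s, c i = 0}

/-- The Schanuel condition for τ: td_{ℚ(τ)}(a) + ldim_{ℚ(τ)}(a) ≥ ldim_ℚ(a)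
for all tuples a of positive reals.  (⊥ : Subfield ℝ) is the prime field ℚ. -/
def SchanuelCond (τ : ℝ) : Prop :=
  ∀ (n : ℕ) (a : Fin n → ℝ), (∀ i, 0 < a i) →
    mldim (⊥ : Subfield ℝ) a ≤ tdeg (Ktau τ) a + mldim (Ktau τ) a

/-- A subset of ℝ which is a subgroup of the multiplicative group of positive reals. -/
def IsMulSubgroup (Γ : Set ℝ) : Prop :=
  (∀ g ∈ Γ, 0 < g) ∧ 1 ∈ Γ ∧ (∀ g ∈ Γ, ∀ h ∈ Γ, g * h ∈ Γ) ∧ ∀ g ∈ Γ, g⁻¹ ∈ Γ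

/-- The K-linear span of Γ in the K-vector space (ℝ_{>0},·). -/
def MulSpan (K : Subfield ℝ) (Γ : Set ℝ) : Set ℝ :=
  {x : ℝ | ∃ (m : ℕ) (g : Fin m → ℝ) (c : Fin m → ℝ),
    (∀ i, g i ∈ Γ) ∧ (∀ i, c i ∈ K) ∧ x = ∏ i, g i ^ c i}


/-- G ≤ ℝ_{>0} has the Mann property over K: every equation a_1x_1+⋯+a_nx_n = 1 with
coefficients in K has only finitely many non-degenerate solutions in G^n. -/
def MannOver (K : Subfield ℝ) (G : Set ℝ) : Prop :=
  ∀ (n : ℕ) (a : Fin n → ℝ), (∀ i, a i ∈ K) →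
    {g : Fin n → ℝ | (∀ i, g i ∈ G) ∧ (∑ i, a i * g i) = 1 ∧
      ∀ I : Finset (Fin n), I.Nonempty → (∑ i ∈ I, a i * g i) ≠ 0}.Finite

lemma prod_exp_rpow {ι : Type*} (s : Finset ι) (v c : ι → ℝ) :
    ∏ i ∈ s, exp (v i) ^ c i = exp (∑ i ∈ s, c i * v i) := by
  rw [Real.exp_sum]
  exact Finset.prod_congr rfl fun i _ => by rw [mul_comm, Real.exp_mul]

lemma exp_intCast_mul (n : ℤ) (x : ℝ) : exp (n * x) = exp x ^ n := by
  rw [mul_comm, Real.exp_mul, Real.rpow_intCast]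

lemma le_mldim_bot {n : ℕ} {v : Fin n → ℝ} (hv : LinearIndependent ℚ v) :
    n ≤ mldim (⊥ : Subfield ℝ) (fun i => exp (v i)) := by
  refine le_csSup ⟨n, ?_⟩ ⟨Finset.univ, by simp, fun c hc h => ?_⟩
  · rintro _ ⟨s, rfl, -⟩
    simpa using s.card_le_univ
  · have hq : ∀ i, ∃ q : ℚ, (q : ℝ) = c i := fun i => by
      have := hc i
      rw [Subfield.bot_eq_of_charZero] at this
      simpa using this
    choose q hq using hq
    rw [prod_exp_rpow, Real.exp_eq_one_iff] at h
    have h0 := Fintype.linearIndependent_iff.1 hv q (by simpa [Rat.smul_def, hq] using h)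
    exact fun i _ => by rw [← hq, h0 i, Rat.cast_zero]

lemma mldim_le_of_mem_span (K : Subfield ℝ) {n m : ℕ} {v : Fin n → ℝ} {u : Fin m → ℝ}
    (hv : ∀ i, v i ∈ Submodule.span K (Set.range u)) :
    mldim K (fun i => exp (v i)) ≤ m := by
  refine csSup_le' ?_
  rintro _ ⟨s, rfl, hs⟩
  have hli : LinearIndepOn K v (s : Set (Fin n)) := by
    rw [linearIndepOn_finset_iff]
    intro f hf i hi
    have := hs (fun i => f i) (fun i => (f i).2) (by
      rw [prod_exp_rpow, Real.exp_eq_one_iff]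
      simpa [Subfield.smul_def] using hf) i hi
    exact_mod_cast this
  have hfin : Module.Finite K (Submodule.span K (Set.range u)) :=
    Module.Finite.span_of_finite K (Set.finite_range u)
  have hli' : LinearIndependent K
      (fun i : (s : Set (Fin n)) => (⟨v i, hv i⟩ : Submodule.span K (Set.range u))) :=
    LinearIndependent.of_comp (Submodule.subtype _) hli
  have h1 := hli'.fintype_card_le_finrank
  have h2 := finrank_range_le_card (R := K) u
  simp only [Fintype.card_fin] at h2
  simpa using h1.trans h2

/-- The Schanuel condition makes the tuple `exp ∘ w` algebraically independent over `K` as soon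
as `w` lies in the `K`-span of `v`, `exp ∘ v` is algebraic, and `v`, `w` are jointly
`ℚ`-linearly independent. -/
lemma algebraicIndependent_exp_of_append {K : Subfield ℝ}
    (hK : ∀ (n : ℕ) (a : Fin n → ℝ), (∀ i, 0 < a i) →
      mldim (⊥ : Subfield ℝ) a ≤ tdeg K a + mldim K a)
    {m k : ℕ} {v : Fin m → ℝ} {w : Fin k → ℝ}
    (hv : ∀ i, IsAlgebraic K (exp (v i)))
    (hw : ∀ j, w j ∈ Submodule.span K (Set.range v))
    (hli : LinearIndependent ℚ (Fin.append v w)) :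
    AlgebraicIndependent K (fun j => exp (w j)) := by
  set a : Fin (m + k) → ℝ := fun i => exp (Fin.append v w i)
  have h1 := le_mldim_bot hli
  have h2 : mldim K a ≤ m := mldim_le_of_mem_span K fun i => by
    refine Fin.addCases (fun i => ?_) (fun j => ?_) i
    · simpa using Submodule.subset_span (Set.mem_range_self i)
    · simpa using hw j
  have h3 : k ≤ tdeg K a := by
    have := hK _ a fun i => Real.exp_pos _
    lia
  obtain ⟨s, hs, hind⟩ : tdeg K a ∈ {d | ∃ s : Finset (Fin (m + k)), s.card = d ∧
      AlgebraicIndependent K (fun i : s => a i)} := by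
    refine Nat.sSup_mem ⟨0, ∅, rfl, algebraicIndependent_empty_type⟩ ⟨m + k, ?_⟩
    rintro _ ⟨s, rfl, -⟩
    simpa using s.card_le_univ
  have hsub : s ⊆ Finset.univ.map (Fin.natAddEmb m) := by
    intro i hi
    induction i using Fin.addCases with
    | left i => exact absurd (by simpa [a] using hv i) (hind.transcendental ⟨_, hi⟩)
    | right j => simp
  have hs' := Finset.eq_of_subset_of_card_le hsub (by simpa [hs] using h3)
  have hmem : ∀ j : Fin k, Fin.natAdd m j ∈ s := fun j => by simp [hs']
  have := hind.comp (fun j : Fin k => ⟨Fin.natAdd m j, hmem j⟩)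
    fun i j h => by simpa using h
  simpa [a, Function.comp_def] using this

lemma algebraicIndependent_exp {K : Subfield ℝ}
    (hK : ∀ (n : ℕ) (a : Fin n → ℝ), (∀ i, 0 < a i) →
      mldim (⊥ : Subfield ℝ) a ≤ tdeg K a + mldim K a)
    {G : Submodule ℚ ℝ} (hG : ∀ g ∈ G, IsAlgebraic K (exp g))
    {k : ℕ} {w : Fin k → ℝ} (hw : ∀ j, w j ∈ Submodule.span K (G : Set ℝ))
    (hli : LinearIndependent ℚ (fun j => G.mkQ (w j))) :
    AlgebraicIndependent K (fun j => exp (w j)) := by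
  classical
  choose T hTG hT using fun j => Submodule.mem_span_finite_of_mem_span (hw j)
  let S : Finset ℝ := Finset.univ.biUnion T
  have hSG : (S : Set ℝ) ⊆ G := by
    intro x hx
    obtain ⟨j, -, hj⟩ := Finset.mem_biUnion.1 hx
    exact hTG j hj
  obtain ⟨b, hbS, hspan, hb⟩ := exists_linearIndependent K (S : Set ℝ)
  have : Fintype b := (S.finite_toSet.subset hbS).fintype
  let e := Fintype.equivFin b
  let v : Fin (Fintype.card b) → ℝ := fun i => e.symm i
  have hvG : ∀ i, v i ∈ G := fun i => hSG (hbS (e.symm i).2)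
  have hvK : LinearIndependent K v := hb.comp e.symm e.symm.injective
  have hrange : Set.range v = b := by
    simp [v, Set.range_comp' (Subtype.val : b → ℝ) e.symm]
  refine algebraicIndependent_exp_of_append hK (v := v) (fun i => hG _ (hvG i)) (fun j => ?_) ?_
  · rw [hrange, hspan]
    exact Submodule.span_mono
      (Finset.coe_subset.2 (Finset.subset_biUnion_of_mem T (Finset.mem_univ j))) (hT j)
  · rw [Fintype.linearIndependent_iff] at hli hvK ⊢
    intro c hc
    rw [Fin.sum_univ_add] at hc
    simp only [Fin.append_left, Fin.append_right] at hc
    have hmem : ∑ i, c (Fin.castAdd k i) • v i ∈ G :=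
      G.sum_mem fun i _ => G.smul_mem _ (hvG i)
    have hw0 := hli (fun j => c (Fin.natAdd _ j)) (by
      have := congrArg G.mkQ hc
      rw [map_add, G.mkQ_apply, (Submodule.Quotient.mk_eq_zero G).2 hmem] at this
      simpa using this)
    have hv0 := hvK (fun i => (c (Fin.castAdd k i) : K)) (by
      simpa [hw0, Rat.smul_def, Subfield.smul_def] using hc)
    intro i
    induction i using Fin.addCases with
    | left i => exact_mod_cast hv0 i
    | right j => exact hw0 j

/-- Laurent monomials in algebraically independent quantities are linearly independent. -/
lemma sum_fiber_eq_zero_of_laurent {L A ι : Type*} [Field L] [Field A] [Algebra L A] [Fintype ι]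
    {k : ℕ} {x : Fin k → A} (hx : AlgebraicIndependent L x) (hx0 : ∀ j, x j ≠ 0)
    (c : ι → L) (p : ι → Fin k → ℤ)
    (h : ∑ i, algebraMap L A (c i) * ∏ j, x j ^ p i j = 0) (q : Fin k → ℤ)
    [DecidablePred (p · = q)] :
    ∑ i with p i = q, c i = 0 := by
  classical
  obtain ⟨N, hN⟩ : ∃ N : ℕ, ∀ i j, 0 ≤ p i j + N := by
    refine ⟨∑ i, ∑ j, (p i j).natAbs, fun i j => ?_⟩
    have h1 : (p i j).natAbs ≤ ∑ j, (p i j).natAbs :=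
      Finset.single_le_sum (f := fun j => (p i j).natAbs) (by simp) (Finset.mem_univ j)
    have h2 : ∑ j, (p i j).natAbs ≤ ∑ i, ∑ j, (p i j).natAbs :=
      Finset.single_le_sum (f := fun i => ∑ j, (p i j).natAbs) (by simp) (Finset.mem_univ i)
    lia
  by_cases hq : ∃ i, p i = q
  swap
  · push Not at hq
    simp [hq]
  obtain ⟨i₀, rfl⟩ := hq
  let E : ι → Fin k →₀ ℕ := fun i => Finsupp.equivFunOnFinite.symm fun j => (p i j + N).toNat
  have hE : ∀ i i', E i = E i' ↔ p i = p i' := by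
    intro i i'
    simp only [E, EmbeddingLike.apply_eq_iff_eq, funext_iff]
    refine forall_congr' fun j => ?_
    have := hN i j
    have := hN i' j
    lia
  have hP := hx.eq_zero_of_aeval_eq_zero (∑ i, MvPolynomial.monomial (E i) (c i)) (by
    rw [map_sum, ← zero_mul (∏ j, x j ^ N), ← h, Finset.sum_mul]
    refine Finset.sum_congr rfl fun i _ => ?_
    rw [MvPolynomial.aeval_monomial, mul_assoc, ← Finset.prod_mul_distrib,
      Finsupp.prod_fintype _ _ (by simp)]
    congr 1
    refine Finset.prod_congr rfl fun j _ => ?_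
    rw [← zpow_natCast, ← zpow_natCast, ← zpow_add₀ (hx0 j)]
    simp [E, hN i j])
  have := congrArg (MvPolynomial.coeff (E i₀)) hP
  simpa [MvPolynomial.coeff_sum, MvPolynomial.coeff_monomial, hE, Finset.sum_filter] using this

/-- A finite family in a `ℚ`-vector space has integer coordinates with respect to
some `ℤ`-linearly independent family in its `ℤ`-span. -/
lemma exists_int_coordinates {V ι : Type*} [AddCommGroup V] [Module ℚ V] [Finite ι]
    (y : ι → V) :
    ∃ (k : ℕ) (b : Fin k → V) (p : ι → Fin k → ℤ), LinearIndependent ℤ b ∧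
      (∀ j, b j ∈ Submodule.span ℤ (Set.range y)) ∧ ∀ i, y i = ∑ j, p i j • b j := by
  let N := Submodule.span ℤ (Set.range y)
  have : Module.Finite ℤ N := Module.Finite.span_of_finite ℤ (Set.finite_range y)
  have : Module.IsTorsionFree ℤ V := Module.IsTorsionFree.trans ℚ
  have : Module.Free ℤ N := Module.free_of_finite_type_torsion_free'
  let B := Module.finBasis ℤ N
  refine ⟨_, fun j => B j, fun i => B.repr ⟨y i, Submodule.subset_span ⟨i, rfl⟩⟩,
    B.linearIndependent.map' N.subtype N.ker_subtype, fun j => (B j).2, fun i => ?_⟩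
  have := congrArg N.subtype (B.sum_repr ⟨y i, Submodule.subset_span ⟨i, rfl⟩⟩)
  rw [map_sum] at this
  exact this.symm

/-- The logarithms of a divisible multiplicative group of positive reals form
a `ℚ`-vector space. -/
def logSubmodule (Γ : Set ℝ) (hΓ : IsMulSubgroup Γ)
    (hdiv : ∀ g ∈ Γ, ∀ k : ℕ, 1 ≤ k → ∃ h ∈ Γ, h ^ k = g) : Submodule ℚ ℝ where
  carrier := {y | exp y ∈ Γ}
  zero_mem' := by simpa using hΓ.2.1
  add_mem' := fun {x y} hx hy => by
    simpa [Real.exp_add] using hΓ.2.2.1 _ hx _ hy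
  smul_mem' := fun q y hy => by
    obtain ⟨h, hh, he⟩ := hdiv _ hy q.den q.pos
    have hexp : exp (q • y) = h ^ q.num := by
      have h0 := hΓ.1 h hh
      have hy : y = q.den * Real.log h := by
        rw [← Real.log_pow, he, Real.log_exp]
      have hq : (q : ℝ) * q.den = q.num := by exact_mod_cast q.mul_den_eq_num
      rw [Rat.smul_def, hy, ← mul_assoc, hq, exp_intCast_mul, Real.exp_log h0]
    have hpow : ∀ n : ℕ, h ^ n ∈ Γ := fun n => by
      induction n with
      | zero => simpa using hΓ.2.1
      | succ n ih => rw [pow_succ]; exact hΓ.2.2.1 _ ih _ hh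
    rw [Set.mem_ofPred_eq, hexp]
    obtain ⟨n, hn | hn⟩ := q.num.eq_nat_or_neg
    · rw [hn, zpow_natCast]; exact hpow n
    · rw [hn, zpow_neg, zpow_natCast]; exact hΓ.2.2.2 _ (hpow n)

lemma exists_log_of_mem_mulSpan {K : Subfield ℝ} {Γ G : Set ℝ} (hpos : ∀ g ∈ Γ, 0 < g)
    (hG : ∀ g ∈ Γ, Real.log g ∈ G) {x : ℝ} (hx : x ∈ MulSpan K Γ) :
    ∃ y ∈ Submodule.span K G, exp y = x := by
  obtain ⟨m, g, c, hg, hc, rfl⟩ := hx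
  refine ⟨∑ i, c i * Real.log (g i), Submodule.sum_mem _ fun i _ => ?_, ?_⟩
  · exact Submodule.smul_mem _ (⟨c i, hc i⟩ : K) (Submodule.subset_span (hG _ (hg i)))
  · rw [← prod_exp_rpow]
    exact Finset.prod_congr rfl fun i _ => by rw [Real.exp_log (hpos _ (hg i))]

/-- Non-degenerate solutions of a unit equation in the exponential of the `K`-span of `G` already
lie in the exponential of `G`. -/
lemma mem_of_nondegenerate {K : Subfield ℝ}
    (hK : ∀ (n : ℕ) (a : Fin n → ℝ), (∀ i, 0 < a i) →
      mldim (⊥ : Subfield ℝ) a ≤ tdeg K a + mldim K a)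
    {G : Submodule ℚ ℝ} (hG : ∀ g ∈ G, IsAlgebraic K (exp g))
    {n : ℕ} {a y : Fin n → ℝ} (ha : ∀ i, a i ∈ K)
    (hy : ∀ i, y i ∈ Submodule.span K (G : Set ℝ)) (hsum : ∑ i, a i * exp (y i) = 1)
    (hnd : ∀ I : Finset (Fin n), I.Nonempty → ∑ i ∈ I, a i * exp (y i) ≠ 0) (i₀ : Fin n) :
    y i₀ ∈ G := by
  classical
  obtain ⟨k, b, p, hb, hbspan, hp⟩ := exists_int_coordinates fun i => G.mkQ (y i)
  have hlift : ∀ j, ∃ w ∈ Submodule.span K (G : Set ℝ), G.mkQ w = b j := fun j => by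
    have hle : Submodule.span ℤ (Set.range fun i => G.mkQ (y i)) ≤
        ((Submodule.span K (G : Set ℝ)).restrictScalars ℤ).map (G.mkQ.restrictScalars ℤ) := by
      rw [Submodule.span_le]
      rintro _ ⟨i, rfl⟩
      exact ⟨y i, hy i, rfl⟩
    exact hle (hbspan j)
  choose w hw hwb using hlift
  have hind : AlgebraicIndependent K (fun j => exp (w j)) := by
    refine algebraicIndependent_exp hK hG hw ?_
    simp only [hwb]
    exact (LinearIndependent.iff_fractionRing ℤ ℚ).1 hb
  have hindL := hind.extendScalars (algebraicClosure K ℝ)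
  let g : Fin n → ℝ := fun i => y i - ∑ j, p i j • w j
  have hgG : ∀ i, g i ∈ G := fun i => by
    rw [← Submodule.Quotient.mk_eq_zero, ← Submodule.mkQ_apply]
    simp only [g, map_sub, map_sum, map_zsmul, hwb, hp i, sub_self]
  have hexp : ∀ i, exp (y i) = exp (g i) * ∏ j, exp (w j) ^ p i j := fun i => by
    have : y i = g i + ∑ j, p i j * w j := by simp [g]
    rw [this, Real.exp_add, Real.exp_sum]
    simp [exp_intCast_mul]
  let c : Option (Fin n) → algebraicClosure K ℝ := fun o => o.elim (-1) fun i =>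
    ⟨a i * exp (g i), mem_algebraicClosure_iff.2
      ((isAlgebraic_algebraMap (⟨a i, ha i⟩ : K)).mul (hG _ (hgG i)))⟩
  let P : Option (Fin n) → Fin k → ℤ := fun o => o.elim 0 p
  have key := sum_fiber_eq_zero_of_laurent hindL (fun j => (Real.exp_pos _).ne') c P (by
    rw [Fintype.sum_option]
    have hterm : ∀ i, algebraMap (algebraicClosure K ℝ) ℝ (c (some i)) *
        ∏ j, exp (w j) ^ P (some i) j = a i * exp (y i) := fun i => by
      rw [hexp, ← mul_assoc]; rfl
    simp only [hterm, hsum]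
    simp [c, P]) (p i₀)
  by_cases hp0 : p i₀ = 0
  · have : y i₀ = g i₀ := by simp [g, hp0]
    exact this ▸ hgG i₀
  · refine absurd ?_ (hnd {i | p i = p i₀} ⟨i₀, by simp⟩)
    rw [Finset.sum_filter, Fintype.sum_option, if_neg (fun h : P none = p i₀ => hp0 h.symm),
      zero_add,
      ← Finset.sum_filter] at key
    have key' : ∑ i with p i = p i₀, a i * exp (g i) = 0 := by
      have := congrArg (algebraMap (algebraicClosure K ℝ) ℝ) key
      rw [map_sum, map_zero] at this
      exact this
    rw [← zero_mul (∏ j, exp (w j) ^ p i₀ j), ← key', Finset.sum_mul]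
    refine Finset.sum_congr rfl fun i hi => ?_
    rw [hexp, (Finset.mem_filter.1 hi).2, mul_assoc]

/-- under the Schanuel condition, with Γ ⊆ ℚ(τ)^{alg} divisible and Δ the
ℚ(τ)-linear span of Γ in (ℝ_{>0},·): if Γ has the Mann property over ℚ(τ), then so
does Δ. -/
theorem stmt8 (τ : ℝ) (hτ : Irrational τ) (hSch : SchanuelCond τ)
    (Γ : Set ℝ) (hΓ : IsMulSubgroup Γ)
    (hdiv : ∀ g ∈ Γ, ∀ k : ℕ, 1 ≤ k → ∃ h ∈ Γ, h ^ k = g)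
    (halg : ∀ g ∈ Γ, IsAlgebraic (Ktau τ) g)
    (hMann : MannOver (Ktau τ) Γ) :
    MannOver (Ktau τ) (MulSpan (Ktau τ) Γ) := by
  let G := logSubmodule Γ hΓ hdiv
  intro n a ha
  refine (hMann n a ha).subset ?_
  rintro x ⟨hx, hsum, hnd⟩
  refine ⟨?_, hsum, hnd⟩
  choose y hy hyx using fun i => exists_log_of_mem_mulSpan (G := (G : Set ℝ)) hΓ.1
    (fun g hg => show exp (Real.log g) ∈ Γ by rwa [Real.exp_log (hΓ.1 g hg)]) (hx i)
  obtain rfl : (fun i => exp (y i)) = x := funext hyx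
  exact mem_of_nondegenerate hSch (G := G) (fun g hg => halg _ hg) ha hy hsum hnd
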